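/- arXiv:2508.01733 — 2 statements merged into one kernel-verified Lean document; each statement's English description precedes it below -/
import Mathlib

section
/- Let O be a nonempty finite set of index pairs with observed dissimilarities D_ij ∈ ℝ for (i,j) ∈ O, and let N be a positive natural number. For a configuration X assigning to each index a point of the N-dimensional Euclidean space ℝ^N, define MAE(X) = (1/|O|)·Σ_{(i,j)∈O} |D_ij - ‖X_i - X_j‖| and the Laplace log-likelihood ℓ(X,b) = Σ_{(i,j)∈O} ( -log(2b) - |D_ij - ‖X_i - X_j‖|/b ) for b > 0. Then for any two configurations X and Y with MAE(X) > 0 and MAE(Y) > 0, sup_{b>0} ℓ(X,b) ≥ sup_{b>0} ℓ(Y,b) if and only if MAE(X) ≤ MAE(Y). In particular, a configuration maximizes the profile Laplace likelihood if and only if it minimizes the MAE. -/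
open scoped BigOperators

/-- The mean absolute error of a configuration `X : ι → ℝ^N` with respect to the
observed dissimilarities `D` on the observation set `O`. -/
noncomputable def topolowMAE {ι : Type*} {N : ℕ} (O : Finset (ι × ι)) (D : ι × ι → ℝ)
    (X : ι → EuclideanSpace ℝ (Fin N)) : ℝ :=
  (1 / (O.card : ℝ)) * ∑ p ∈ O, |D p - ‖X p.1 - X p.2‖|

/-- The Laplace log-likelihood of a configuration `X` with scale parameter `b`:
`ℓ(X,b) = Σ_{(i,j)∈O} (-log(2b) - |D_ij - ‖X_i - X_j‖|/b)`. -/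
noncomputable def topolowLogLik {ι : Type*} {N : ℕ} (O : Finset (ι × ι)) (D : ι × ι → ℝ)
    (X : ι → EuclideanSpace ℝ (Fin N)) (b : ℝ) : ℝ :=
  ∑ p ∈ O, (-Real.log (2 * b) - |D p - ‖X p.1 - X p.2‖| / b)

theorem topolow_logLik_eq {ι : Type*} {N : ℕ} (O : Finset (ι × ι)) (hO : O.Nonempty)
    (D : ι × ι → ℝ) (X : ι → EuclideanSpace ℝ (Fin N)) (b : ℝ) :
    topolowLogLik O D X b = (O.card : ℝ) * (-Real.log (2 * b) - topolowMAE O D X / b) := by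
  have hn : (O.card : ℝ) ≠ 0 := by exact_mod_cast hO.card_pos.ne'
  unfold topolowLogLik topolowMAE
  rw [Finset.sum_sub_distrib, ← Finset.sum_div, Finset.sum_const, nsmul_eq_mul, mul_sub]
  congr 1
  rw [← mul_div_assoc, ← mul_assoc, mul_one_div_cancel hn, one_mul]

theorem topolow_profile_eq {ι : Type*} {N : ℕ} (O : Finset (ι × ι)) (hO : O.Nonempty)
    (D : ι × ι → ℝ) (X : ι → EuclideanSpace ℝ (Fin N)) (hX : 0 < topolowMAE O D X) :
    sSup ((fun b => topolowLogLik O D X b) '' Set.Ioi 0) =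
      (O.card : ℝ) * (-Real.log (2 * topolowMAE O D X) - 1) := by
  apply IsGreatest.csSup_eq
  constructor
  · refine ⟨topolowMAE O D X, hX, ?_⟩
    simp only [topolow_logLik_eq O hO]
    rw [div_self hX.ne']
  · rintro _ ⟨b, hb, rfl⟩
    have hb' : 0 < b := hb
    simp only [topolow_logLik_eq O hO]
    apply mul_le_mul_of_nonneg_left _ (Nat.cast_nonneg _)
    have h := Real.log_le_sub_one_of_pos (div_pos hX hb')
    rw [Real.log_div hX.ne' hb'.ne'] at h
    rw [Real.log_mul two_ne_zero hX.ne', Real.log_mul two_ne_zero hb'.ne']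
    linarith

/-- Maximizing the profile Laplace likelihood over the scale parameter `b > 0`
is equivalent to minimizing the MAE: for configurations `X, Y` with positive MAE,
`sup_{b>0} ℓ(X,b) ≥ sup_{b>0} ℓ(Y,b) ↔ MAE(X) ≤ MAE(Y)`. -/
theorem topolow_profile_likelihood_iff_MAE {ι : Type*} (N : ℕ) (hN : 0 < N)
    (O : Finset (ι × ι)) (hO : O.Nonempty) (D : ι × ι → ℝ)
    (X Y : ι → EuclideanSpace ℝ (Fin N))
    (hX : 0 < topolowMAE O D X) (hY : 0 < topolowMAE O D Y) :
    sSup ((fun b => topolowLogLik O D X b) '' Set.Ioi 0)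
        ≥ sSup ((fun b => topolowLogLik O D Y b) '' Set.Ioi 0)
      ↔ topolowMAE O D X ≤ topolowMAE O D Y := by
  have hn : (0 : ℝ) < O.card := by exact_mod_cast hO.card_pos
  rw [topolow_profile_eq O hO D X hX, topolow_profile_eq O hO D Y hY, ge_iff_le,
    mul_le_mul_iff_right₀ hn, sub_le_sub_iff_right, neg_le_neg_iff,
    Real.log_le_log_iff (by positivity) (by positivity),
    mul_le_mul_iff_right₀ (by norm_num)]
end

section
/- Let n be a positive natural number and let D be an n × n real matrix that is a Euclidean distance matrix, i.e., there exist a natural number m and points x_1, …, x_n in m-dimensional Euclidean space ℝ^m such that D_ij = ‖x_i - x_j‖ for all i, j. Let J = I - (1/n)·𝟙 be the centering matrix, where 𝟙 is the n × n all-ones matrix, and let D⁽²⁾ denote the matrix with entries (D_ij)². Then the Gram matrix B = -(1/2)·J·D⁽²⁾·J is positive semidefinite. -/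
open Matrix

/-- Torgerson–Gower: if `D` is a Euclidean distance matrix (i.e. `D i j = ‖x i - x j‖`
for some points `x` in `ℝ^m`), then the doubly centered Gram matrix
`B = -(1/2)·J·D⁽²⁾·J`, with centering matrix `J = I - (1/n)·𝟙` and `D⁽²⁾` the matrix
of squared entries, is positive semidefinite. -/
theorem torgerson_gower_posSemidef (n : ℕ) (hn : 0 < n)
    (D : Matrix (Fin n) (Fin n) ℝ)
    (hD : ∃ (m : ℕ) (x : Fin n → EuclideanSpace ℝ (Fin m)),
      ∀ i j, D i j = ‖x i - x j‖) :
    letI J : Matrix (Fin n) (Fin n) ℝ := 1 - (1 / (n : ℝ)) • Matrix.of (fun _ _ => 1)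
    letI Dsq : Matrix (Fin n) (Fin n) ℝ := Matrix.of (fun i j => (D i j) ^ 2)
    ((-(1 / 2) : ℝ) • (J * Dsq * J)).PosSemidef := by
  obtain ⟨m, x, hx⟩ := hD
  let J : Matrix (Fin n) (Fin n) ℝ := 1 - (1 / (n : ℝ)) • Matrix.of (fun _ _ => 1)
  let Dsq : Matrix (Fin n) (Fin n) ℝ := Matrix.of (fun i j => (D i j) ^ 2)
  change ((-(1 / 2) : ℝ) • (J * Dsq * J)).PosSemidef
  have hn' : (n : ℝ) ≠ 0 := by exact_mod_cast hn.ne'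
  let E : Matrix (Fin n) (Fin n) ℝ := Matrix.of (fun _ _ => 1)
  let X : Matrix (Fin n) (Fin m) ℝ := Matrix.of (fun i k => x i k)
  let d : Matrix (Fin n) (Fin n) ℝ := Matrix.diagonal (fun i => ‖x i‖ ^ 2)
  have hJ : J = 1 - (1 / (n : ℝ)) • E := rfl
  have hEE : E * E = (n : ℝ) • E := by
    ext i j
    simp [E, Matrix.mul_apply]
  have hEJ : E * J = 0 := by
    rw [hJ, mul_sub, mul_one, Matrix.mul_smul, hEE, smul_smul, one_div_mul_cancel hn', one_smul,
      sub_self]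
  have hJE : J * E = 0 := by
    rw [hJ, sub_mul, one_mul, Matrix.smul_mul, hEE, smul_smul, one_div_mul_cancel hn', one_smul,
      sub_self]
  have hJT : Jᴴ = J := by
    ext i j
    simp [hJ, E, Matrix.one_apply, eq_comm]
  have hD2 : Dsq = d * E + E * d - (2 : ℝ) • (X * Xᴴ) := by
    ext i j
    have h1 : (X * Xᴴ) i j = inner ℝ (x i) (x j) := by
      simp [X, Matrix.mul_apply, PiLp.inner_apply, mul_comm]
    have h2 := norm_sub_sq_real (x i) (x j)
    simp only [Matrix.sub_apply, Matrix.add_apply, Matrix.smul_apply, h1]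
    simp only [Dsq, d, E, Matrix.diagonal_mul, Matrix.mul_diagonal, Matrix.of_apply, hx, h2,
      smul_eq_mul]
    ring
  clear_value J Dsq E d X
  have key : (-(1 / 2) : ℝ) • (J * Dsq * J) = (J * X) * (J * X)ᴴ := by
    have e1 : J * (d * E) * J = 0 := by
      rw [Matrix.mul_assoc, Matrix.mul_assoc, hEJ]; simp
    have e2 : J * (E * d) * J = 0 := by
      rw [← Matrix.mul_assoc, hJE]; simp
    rw [hD2, mul_sub, mul_add, sub_mul, add_mul, e1, e2, Matrix.conjTranspose_mul, hJT,
      Matrix.mul_smul, Matrix.smul_mul, add_zero, zero_sub, smul_neg, smul_smul]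
    norm_num [Matrix.mul_assoc]
  rw [key]
  exact Matrix.posSemidef_self_mul_conjTranspose _
end
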